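/- Let a², c² > 0, k ∈ ℤ∖{0}, and set b² = 0, so that s₊ = (√(24 a² c²))/(4c²). Then there is NO pair of functions u, v ∈ C²((0,∞)) satisfying the ODE system u'' + u'/r − k²u/r² = u[−a² + c²(u² + v²)] and v'' + v'/r = v[−a² + c²(u² + v²)] on (0,∞) with u(r) > 0 and v(r) < 0 for all r ∈ (0,∞) and lim_{r→∞} u(r) = s₊/√2, lim_{r→∞} v(r) = −s₊/√6. -/

import Mathlib

open Filter Topology in
/-- A function whose derivative is eventually at most `-c / r` with `c > 0` diverges to `-∞`. -/
theorem tendsto_atBot_of_hasDerivAt_le_neg_div {f f' : ℝ → ℝ} {c : ℝ} (hc : 0 < c)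
    (h : ∀ᶠ r in atTop, HasDerivAt f (f' r) r ∧ f' r ≤ -c / r) : Tendsto f atTop atBot := by
  obtain ⟨R, hR⟩ := eventually_atTop.1 (h.and (eventually_gt_atTop 0))
  have hderiv : ∀ r, R ≤ r → HasDerivAt (fun x => f x + c * Real.log x) (f' r + c * r⁻¹) r :=
    fun r hr => (hR r hr).1.1.add ((Real.hasDerivAt_log (hR r hr).2.ne').const_mul c)
  have hanti : AntitoneOn (fun x => f x + c * Real.log x) (Set.Ici R) := by
    refine antitoneOn_of_deriv_nonpos (convex_Ici R)
      (fun r hr => (hderiv r hr).continuousAt.continuousWithinAt)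
      (fun r hr => ?_) (fun r hr => ?_) <;> rw [interior_Ici] at hr
    · exact (hderiv r hr.le).differentiableAt.differentiableWithinAt
    · rw [(hderiv r hr.le).deriv]
      have := (hR r hr.le).1.2
      rw [neg_div, div_eq_mul_inv] at this
      linarith
  have hlim : Tendsto (fun r => (f R + c * Real.log R) + -(c * Real.log r)) atTop atBot :=
    tendsto_atBot_add_const_left _ _
      (tendsto_neg_atTop_atBot.comp (Real.tendsto_log_atTop.const_mul_atTop hc))
  refine tendsto_atBot_mono' _ ?_ hlim
  filter_upwards [eventually_ge_atTop R] with r hr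
  have := hanti Set.self_mem_Ici hr hr
  dsimp only at this
  linarith

/-- A `C²` function on `(0, ∞)` is twice differentiable there. -/
theorem ContDiffOn.hasDerivAt_and_hasDerivAt_deriv {f : ℝ → ℝ} (hf : ContDiffOn ℝ 2 f (Set.Ioi 0))
    {r : ℝ} (hr : 0 < r) :
    HasDerivAt f (deriv f r) r ∧ HasDerivAt (deriv f) (deriv (deriv f) r) r := by
  refine ⟨((hf.differentiableOn (by norm_num)).differentiableAt (Ioi_mem_nhds hr)).hasDerivAt, ?_⟩
  have h1 : ContDiffOn ℝ 1 (deriv f) (Set.Ioi 0) := hf.deriv_of_isOpen isOpen_Ioi (by norm_num)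
  exact ((h1.differentiableOn (by norm_num)).differentiableAt (Ioi_mem_nhds hr)).hasDerivAt

open Filter Topology in
/-- If `u` and `v` solve linear radial equations with a common potential `p`, the one for `u`
having the extra term `-κ u / r²` with `κ > 0`, then `u` and `v` cannot converge to limits of
strictly opposite signs at infinity. -/
theorem not_tendsto_of_radial_system {u v p : ℝ → ℝ} {κ A B : ℝ} (hκ : 0 < κ)
    (hA : 0 < A) (hB : B < 0)
    (hu : ContDiffOn ℝ 2 u (Set.Ioi 0)) (hv : ContDiffOn ℝ 2 v (Set.Ioi 0))
    (hode_u : ∀ r, 0 < r → deriv (deriv u) r + deriv u r / r - κ * u r / r ^ 2 = u r * p r)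
    (hode_v : ∀ r, 0 < r → deriv (deriv v) r + deriv v r / r = v r * p r)
    (hu_lim : Tendsto u atTop (𝓝 A)) (hv_lim : Tendsto v atTop (𝓝 B)) : False := by
  have hW : Tendsto (fun r => r * (deriv u r * v r - u r * deriv v r)) atTop atBot := by
    have hAB : A * B < 0 := mul_neg_of_pos_of_neg hA hB
    refine tendsto_atBot_of_hasDerivAt_le_neg_div (f' := fun r => κ * (u r * v r) / r)
      (c := κ * -(A * B / 2)) (mul_pos hκ (by linarith)) ?_
    filter_upwards [eventually_gt_atTop 0,
      (hu_lim.mul hv_lim).eventually_lt_const (show A * B < A * B / 2 by linarith)] with r hr huv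
    obtain ⟨hu1, hu2⟩ := hu.hasDerivAt_and_hasDerivAt_deriv hr
    obtain ⟨hv1, hv2⟩ := hv.hasDerivAt_and_hasDerivAt_deriv hr
    constructor
    · refine ((hasDerivAt_id' r).mul ((hu2.mul hv1).sub (hu1.mul hv2))).congr_deriv ?_
      have h1 : deriv (deriv u) r = u r * p r + κ * u r / r ^ 2 - deriv u r / r := by
        linarith [hode_u r hr]
      have h2 : deriv (deriv v) r = v r * p r - deriv v r / r := by linarith [hode_v r hr]
      simp only [Pi.mul_apply, Pi.sub_apply, h1, h2]
      field_simp
      ring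
    · gcongr
      nlinarith
  have hquot : Tendsto (fun r => u r / v r) atTop atBot := by
    refine tendsto_atBot_of_hasDerivAt_le_neg_div
      (f' := fun r => (deriv u r * v r - u r * deriv v r) / v r ^ 2)
      (c := 1 / (B ^ 2 + 1)) (by positivity) ?_
    filter_upwards [eventually_gt_atTop 0, hv_lim.eventually_lt_const hB,
      (hv_lim.pow 2).eventually_lt_const (lt_add_one (B ^ 2)),
      hW.eventually_le_atBot (-1)] with r hr hvr hv2 hWr
    refine ⟨(hu.hasDerivAt_and_hasDerivAt_deriv hr).1.div
      (hv.hasDerivAt_and_hasDerivAt_deriv hr).1 hvr.ne, ?_⟩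
    have hvpos : 0 < v r ^ 2 := sq_pos_of_neg hvr
    have hinv : 1 / (B ^ 2 + 1) ≤ 1 / v r ^ 2 := one_div_le_one_div_of_le hvpos hv2.le
    calc (deriv u r * v r - u r * deriv v r) / v r ^ 2
        ≤ (-1 / r) / v r ^ 2 := by
          gcongr
          rw [le_div_iff₀ hr]
          linarith
      _ = -(1 / v r ^ 2) / r := by field_simp
      _ ≤ -(1 / (B ^ 2 + 1)) / r := by gcongr
  exact not_tendsto_nhds_of_tendsto_atBot hquot _ (hu_lim.div hv_lim hB.ne)


open Real Matrix
open scoped ENNReal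

noncomputable section

abbrev Mat3 := Matrix (Fin 3) (Fin 3) ℝ

/-- `Q` is a symmetric traceless 3×3 real matrix, i.e. an element of `S₀`. -/
def isS0 (Q : Mat3) : Prop := Qᵀ = Q ∧ Q.trace = 0

def e1 : Fin 3 → ℝ := ![1, 0, 0]
def e2 : Fin 3 → ℝ := ![0, 1, 0]
def e3 : Fin 3 → ℝ := ![0, 0, 1]

/-- `n(φ) = (cos(kφ/2), sin(kφ/2), 0)`. -/
def nvec (k : ℤ) (φ : ℝ) : Fin 3 → ℝ := ![Real.cos ((k : ℝ) * φ / 2), Real.sin ((k : ℝ) * φ / 2), 0]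

/-- `m(φ) = (−sin(kφ/2), cos(kφ/2), 0)`. -/
def mvec (k : ℤ) (φ : ℝ) : Fin 3 → ℝ := ![-Real.sin ((k : ℝ) * φ / 2), Real.cos ((k : ℝ) * φ / 2), 0]

/-- `I₂ = I₃ − e₃ ⊗ e₃`. -/
def I2 : Mat3 := 1 - vecMulVec e3 e3

def E0 : Mat3 := Real.sqrt (3/2) • (vecMulVec e3 e3 - (1/3 : ℝ) • (1 : Mat3))
def E1 (k : ℤ) (φ : ℝ) : Mat3 :=
  Real.sqrt 2 • (vecMulVec (nvec k φ) (nvec k φ) - (1/2 : ℝ) • I2)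
def E2mat (k : ℤ) (φ : ℝ) : Mat3 :=
  (Real.sqrt 2)⁻¹ • (vecMulVec (nvec k φ) (mvec k φ) + vecMulVec (mvec k φ) (nvec k φ))
def E3mat : Mat3 := (Real.sqrt 2)⁻¹ • (vecMulVec e1 e3 + vecMulVec e3 e1)
def E4mat : Mat3 := (Real.sqrt 2)⁻¹ • (vecMulVec e2 e3 + vecMulVec e3 e2)

/-- The rotation `R_k(ψ)` of winding `k/2` about the vertical axis. -/
def Rk (k : ℤ) (ψ : ℝ) : Mat3 :=
  !![Real.cos ((k : ℝ) * ψ / 2), -Real.sin ((k : ℝ) * ψ / 2), 0;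
     Real.sin ((k : ℝ) * ψ / 2),  Real.cos ((k : ℝ) * ψ / 2), 0;
     0, 0, 1]

/-- The Landau-de Gennes bulk potential. -/
def fbulk (a2 b2 c2 : ℝ) (Q : Mat3) : ℝ :=
  -(a2/2) * (Q*Q).trace - (b2/3) * (Q*Q*Q).trace + (c2/4) * ((Q*Q).trace)^2

/-- The constant `s₊ = (b² + √(b⁴ + 24a²c²))/(4c²)`. -/
def splus (a2 b2 c2 : ℝ) : ℝ := (b2 + Real.sqrt (b2^2 + 24*a2*c2)) / (4*c2)

/-- Laplacian of a scalar function on `ℝ²`, as the sum of the two repeated partial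
derivatives along the coordinate axes. -/
def lap (f : ℝ × ℝ → ℝ) (p : ℝ × ℝ) : ℝ :=
  deriv (fun t => deriv (fun s => f (s, p.2)) t) p.1 +
  deriv (fun t => deriv (fun s => f (p.1, s)) t) p.2

/-- Componentwise Laplacian of a matrix-valued map on `ℝ²`. -/
def matLap (Q : ℝ × ℝ → Mat3) (p : ℝ × ℝ) : Mat3 :=
  Matrix.of fun i j => lap (fun x => Q x i j) p

/-- Squared norm of the gradient of a scalar function on `ℝ²`. -/
def gradNormSq (f : ℝ × ℝ → ℝ) (p : ℝ × ℝ) : ℝ :=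
  (fderiv ℝ f p (1, 0))^2 + (fderiv ℝ f p (0, 1))^2

/-- `|∇Q|²`: sum over all matrix entries of the squared norms of their gradients. -/
def matGradNormSq (Q : ℝ × ℝ → Mat3) (p : ℝ × ℝ) : ℝ :=
  ∑ i, ∑ j, gradNormSq (fun x => Q x i j) p

/-- Membership in the open disk of radius `R ∈ (0,∞]` centered at the origin. -/
def inBall (R : ℝ≥0∞) (x : ℝ × ℝ) : Prop :=
  ENNReal.ofReal (Real.sqrt (x.1^2 + x.2^2)) < R

/-- The right-hand side of the Euler–Lagrange equation
`ΔQ = −a²Q − b²(Q² − (1/3)|Q|²I₃) + c²|Q|²Q`. -/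
def ELrhs (a2 b2 c2 : ℝ) (A : Mat3) : Mat3 :=
  -a2 • A - b2 • (A * A - ((1/3 : ℝ) * (A * A).trace) • (1 : Mat3)) + (c2 * (A * A).trace) • A

/-- Frobenius squared norm of a 3×3 matrix. -/
def frobSq (A : Mat3) : ℝ := ∑ i, ∑ j, (A i j)^2

/-- For `x = (x₁,x₂) ∈ ℝ²`, `x̃ = (x₁,x₂,0) ∈ ℝ³`. -/
def tilde (x : ℝ × ℝ) : Fin 3 → ℝ := ![x.1, x.2, 0]

/-- The projection `P₂(x₁,x₂,x₃) = (x₁,x₂)`. -/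
def P2 (v : Fin 3 → ℝ) : ℝ × ℝ := (v 0, v 1)

/-- The antisymmetric matrix `S₀ = e₂⊗e₁ − e₁⊗e₂`. -/
def S0mat : Mat3 := vecMulVec e2 e1 - vecMulVec e1 e2

end
/-- for `b² = 0` there is no solution of the ODE system on `(0,∞)` with
`u > 0`, `v < 0` and the stated limits at infinity. -/
theorem stmt3 (a2 c2 : ℝ) (ha : 0 < a2) (hc : 0 < c2) (k : ℤ) (hk : k ≠ 0) :
    ¬ ∃ u v : ℝ → ℝ,
      ContDiffOn ℝ 2 u (Set.Ioi 0) ∧ ContDiffOn ℝ 2 v (Set.Ioi 0) ∧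
      (∀ r : ℝ, 0 < r →
        (deriv (deriv u) r + deriv u r / r - (k : ℝ)^2 * u r / r^2 =
          u r * (-a2 + c2 * ((u r)^2 + (v r)^2))) ∧
        (deriv (deriv v) r + deriv v r / r = v r * (-a2 + c2 * ((u r)^2 + (v r)^2)))) ∧
      (∀ r : ℝ, 0 < r → 0 < u r ∧ v r < 0) ∧
      Filter.Tendsto u Filter.atTop (nhds (splus a2 0 c2 / Real.sqrt 2)) ∧
      Filter.Tendsto v Filter.atTop (nhds (-(splus a2 0 c2) / Real.sqrt 6)) := by
  rintro ⟨u, v, hu, hv, hode, -, hu_lim, hv_lim⟩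
  have hs : 0 < splus a2 0 c2 := by
    unfold splus
    have : 0 < Real.sqrt (0 ^ 2 + 24 * a2 * c2) := Real.sqrt_pos.2 (by positivity)
    positivity
  have hk2 : (0 : ℝ) < (k : ℝ) ^ 2 := by positivity
  exact not_tendsto_of_radial_system hk2 (by positivity)
    (div_neg_of_neg_of_pos (neg_neg_of_pos hs) (by positivity)) hu hv
    (fun r hr => (hode r hr).1) (fun r hr => (hode r hr).2) hu_lim hv_lim
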